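/- arXiv:1401.2120 — 9 statements merged into one kernel-verified Lean document; each statement's English description precedes it below -/
import Mathlib

section
/- Let H be a type-1 quasi-cyclic parity-check matrix (determined by a family v with each circulant block of weight at most 1) with weight matrix H^W. Suppose there exists a nonzero vector c_W : Fin n → ZMod 2 with H^W.mulVec c_W = 0 whose support has cardinality d. Then there exists a nonzero vector c : Fin n × ZMod s → ZMod 2 with H.mulVec c = 0 whose support has cardinality at most d * s. (Hence the minimum distance of the QC LDPC code is at most d·s, where d is the minimum distance of the code with parity-check matrix H^W.) -/
/-- If the weight matrix `H^W` of a type-1 QC parity-check matrix `H`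
has a nonzero codeword `c_W` of weight `d`, then `H` has a nonzero codeword of
weight at most `d * s`. -/
theorem qc_min_dist_le_base_dist_mul_s
    (m n s : ℕ) (hm : 0 < m) (hn : 0 < n) [NeZero s]
    (v : Fin m → Fin n → (ZMod s → ZMod 2))
    (hv : ∀ i j, ∀ a b : ZMod s, v i j a ≠ 0 → v i j b ≠ 0 → a = b)
    (H : Matrix (Fin m × ZMod s) (Fin n × ZMod s) (ZMod 2))
    (hH : ∀ (i : Fin m) (a : ZMod s) (j : Fin n) (b : ZMod s),
      H (i, a) (j, b) = v i j (a - b))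
    (HW : Matrix (Fin m) (Fin n) (ZMod 2))
    (hHW : ∀ i j, HW i j = if v i j ≠ 0 then 1 else 0)
    (cW : Fin n → ZMod 2) (hcW : cW ≠ 0) (hker : HW.mulVec cW = 0)
    (d : ℕ) (hd : (Finset.univ.filter fun j => cW j ≠ 0).card = d) :
    ∃ c : Fin n × ZMod s → ZMod 2, c ≠ 0 ∧ H.mulVec c = 0 ∧
      (Finset.univ.filter fun x => c x ≠ 0).card ≤ d * s := by
  have key : ∀ i j (a : ZMod s), ∑ b : ZMod s, v i j (a - b) = HW i j := by
    intro i j a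
    rw [hHW]
    have h1 : ∑ b : ZMod s, v i j (a - b) = ∑ b : ZMod s, v i j b :=
      Equiv.sum_comp (Equiv.subLeft a) (v i j)
    rw [h1]
    split_ifs with h
    · obtain ⟨x, hx⟩ := Function.ne_iff.mp h
      have hx' : v i j x ≠ 0 := hx
      rw [Finset.sum_eq_single x]
      · have h2 : ∀ z : ZMod 2, z ≠ 0 → z = 1 := by decide
        exact h2 _ hx'
      · intro b _ hb
        by_contra hne
        exact hb (hv i j b x hne hx')
      · simp
    · have h' : v i j = 0 := not_not.mp h
      simp [h']
  refine ⟨fun x => cW x.1, ?_, ?_, ?_⟩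
  · obtain ⟨j, hj⟩ := Function.ne_iff.mp hcW
    intro h
    exact hj (congrFun h (j, 0))
  · funext ⟨i, a⟩
    have h3 := congrFun hker i
    simp only [Matrix.mulVec, dotProduct, Pi.zero_apply] at h3 ⊢
    rw [Fintype.sum_prod_type, ← h3]
    refine Finset.sum_congr rfl fun j _ => ?_
    simp only [hH]
    rw [← Finset.sum_mul, key]
  · have h4 : (Finset.univ.filter fun x : Fin n × ZMod s => cW x.1 ≠ 0)
        = (Finset.univ.filter fun j => cW j ≠ 0) ×ˢ (Finset.univ : Finset (ZMod s)) := by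
      ext x
      simp
    rw [h4, Finset.card_product, hd, Finset.card_univ, ZMod.card]
end

section
/- Let H be a type-1 quasi-cyclic parity-check matrix with weight matrix H^W, and let c_W : Fin n → ZMod 2 satisfy H^W.mulVec c_W = 0. Define c : Fin n × ZMod s → ZMod 2 by c (j, b) = c_W j for all b ∈ ZMod s (i.e. c is constant on each length-s block, equal to the all-ones word on blocks in the support of c_W and zero elsewhere). Then H.mulVec c = 0, and the support of c has cardinality exactly s·d, where d is the cardinality of the support of c_W. -/
/-- Lifting a codeword `c_W` of the weight matrix to a codeword of the
QC parity-check matrix `H` that is constant on each length-`s` block: the lift is a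
codeword of `H` and its weight is exactly `s * d` where `d` is the weight of `c_W`. -/
theorem qc_lift_constant_blocks_codeword
    (m n s : ℕ) (hm : 0 < m) (hn : 0 < n) [NeZero s]
    (v : Fin m → Fin n → (ZMod s → ZMod 2))
    (hv : ∀ i j, ∀ a b : ZMod s, v i j a ≠ 0 → v i j b ≠ 0 → a = b)
    (H : Matrix (Fin m × ZMod s) (Fin n × ZMod s) (ZMod 2))
    (hH : ∀ (i : Fin m) (a : ZMod s) (j : Fin n) (b : ZMod s),
      H (i, a) (j, b) = v i j (a - b))
    (HW : Matrix (Fin m) (Fin n) (ZMod 2))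
    (hHW : ∀ i j, HW i j = if v i j ≠ 0 then 1 else 0)
    (cW : Fin n → ZMod 2) (hker : HW.mulVec cW = 0)
    (d : ℕ) (hd : (Finset.univ.filter fun j => cW j ≠ 0).card = d)
    (c : Fin n × ZMod s → ZMod 2)
    (hc : ∀ (j : Fin n) (b : ZMod s), c (j, b) = cW j) :
    H.mulVec c = 0 ∧ (Finset.univ.filter fun x => c x ≠ 0).card = s * d := by
  have key : ∀ i j (a : ZMod s), ∑ b, v i j (a - b) = HW i j := by
    intro i j a
    have h1 : ∑ b, v i j (a - b) = ∑ b, v i j b :=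
      Equiv.sum_comp (Equiv.subLeft a) (v i j)
    rw [h1, hHW]
    split_ifs with h
    · obtain ⟨x, hx⟩ := Function.ne_iff.mp h
      have hx' : v i j x ≠ 0 := hx
      rw [Finset.sum_eq_single x]
      · have h2 : ∀ z : ZMod 2, z ≠ 0 → z = 1 := by decide
        exact h2 _ hx'
      · intro b _ hb
        by_contra hne
        exact hb (hv i j b x hne hx')
      · intro hx2
        exact absurd (Finset.mem_univ x) hx2
    · have h0 : v i j = 0 := not_not.mp h
      simp [h0]
  constructor
  · funext ⟨i, a⟩
    have hk := congrFun hker i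
    simp only [Matrix.mulVec, dotProduct, Pi.zero_apply] at hk ⊢
    rw [Fintype.sum_prod_type, ← hk]
    refine Finset.sum_congr rfl fun j _ => ?_
    simp only [hH, hc]
    rw [← Finset.sum_mul, key]
  · have h3 : (Finset.univ.filter fun x => c x ≠ 0)
        = (Finset.univ.filter fun j => cW j ≠ 0) ×ˢ (Finset.univ : Finset (ZMod s)) := by
      ext ⟨j, b⟩
      simp [hc]
    rw [h3, Finset.card_product, hd, Finset.card_univ, ZMod.card, mul_comm]
end

section
/- (Smarandache–Vontobel codeword construction, characteristic-2 version.) Let s ≥ 1, let R_s = (ZMod 2)[X] ⧸ Ideal.span {X^s − 1}, let H : Matrix (Fin m) (Fin n) R_s, and let e : Fin (m+1) → Fin n be injective. For j : Fin (m+1), let Δ_j ∈ R_s be the determinant of the m×m matrix obtained from the columns e 0, …, e m of H by deleting column e j (i.e. det of (H.submatrix id e).submatrix id (Fin.succAbove j)). Define c : Fin n → R_s by c (e j) = Δ_j and c t = 0 for t outside the range of e. Then H.mulVec c = 0, i.e. c is a codeword of the code with polynomial parity-check matrix H. -/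
open Polynomial

theorem sv_aux {R : Type*} [CommRing R] (h1 : (-1 : R) = 1) (m n : ℕ)
    (H : Matrix (Fin m) (Fin n) R)
    (e : Fin (m + 1) → Fin n) (he : Function.Injective e) (c : Fin n → R)
    (hc1 : ∀ j : Fin (m + 1),
      c (e j) = ((H.submatrix id e).submatrix id (Fin.succAbove j)).det)
    (hc2 : ∀ t : Fin n, t ∉ Set.range e → c t = 0) :
    H.mulVec c = 0 := by
  funext i
  let A : Matrix (Fin (m + 1)) (Fin (m + 1)) R :=
    Matrix.of (Fin.cons (fun j => H i (e j)) (fun k j => H k (e j)))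
  have hA : A.det = 0 := by
    refine Matrix.det_zero_of_row_eq (i := 0) (j := i.succ) (Fin.succ_ne_zero i).symm ?_
    funext j
    simp [A]
  rw [Matrix.det_succ_row_zero] at hA
  have hsum := Fintype.sum_of_injective e he (fun j => H i (e j) * c (e j))
    (fun t => H i t * c t) (fun t ht => by simp [hc2 t ht]) (fun j => rfl)
  change ∑ t, H i t * c t = 0
  rw [← hsum, ← hA]
  refine Finset.sum_congr rfl fun j _ => ?_
  rw [h1, one_pow, one_mul, hc1]
  rfl

/-- Smarandache–Vontobel codeword construction, characteristic 2:
Over `R_s = (ZMod 2)[X] ⧸ (X^s - 1)`, given `m+1` distinct columns `e 0, …, e m`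
of a polynomial parity-check matrix `H`, the vector with entry `Δ_j` (the maximal
minor deleting column `e j`) at position `e j` and `0` elsewhere is a codeword. -/
theorem smarandache_vontobel_codeword
    (s : ℕ) (hs : 1 ≤ s) (m n : ℕ)
    (H : Matrix (Fin m) (Fin n)
      (Polynomial (ZMod 2) ⧸ Ideal.span {(X : Polynomial (ZMod 2)) ^ s - 1}))
    (e : Fin (m + 1) → Fin n) (he : Function.Injective e)
    (c : Fin n → Polynomial (ZMod 2) ⧸ Ideal.span {(X : Polynomial (ZMod 2)) ^ s - 1})
    (hc1 : ∀ j : Fin (m + 1),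
      c (e j) = ((H.submatrix id e).submatrix id (Fin.succAbove j)).det)
    (hc2 : ∀ t : Fin n, t ∉ Set.range e → c t = 0) :
    H.mulVec c = 0 := by
  refine sv_aux ?_ m n H e he c hc1 hc2
  have h : (-1 : Polynomial (ZMod 2)) = 1 := by
    rw [← Polynomial.C_1, ← Polynomial.C_neg]
    exact congrArg _ (by decide)
  have h2 := congrArg (Ideal.Quotient.mk (Ideal.span {(X : Polynomial (ZMod 2)) ^ s - 1})) h
  simpa only [map_neg, map_one] using h2
end

section
/- Let M : Matrix (Fin m) (Fin m) (ZMod 2) be a binary m×m matrix, for each column j let c_j be the number of indices i with M i j ≠ 0, and let b_1 ≥ b_2 ≥ ⋯ ≥ b_m be the column weights c_1, …, c_m sorted in descending order. Then the number of permutations σ of Fin m such that M i (σ i) ≠ 0 for every i is at most ∏_{i=1}^{m} min(i, b_i). -/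
open Classical in
theorem card_inj_aux {α : Type*} [Fintype α] (n : ℕ) : ∀ (A : Fin n → Finset α) (S : Finset α),
    S.card = n →
    (Finset.univ.filter fun τ : Fin n → α =>
      Function.Injective τ ∧ ∀ i, τ i ∈ A i ∧ τ i ∈ S).card ≤
      ∏ i : Fin n, min ((i : ℕ) + 1) (A i).card := by
  induction n with
  | zero =>
    intro A S _
    refine (Finset.card_le_univ _).trans ?_
    simp
  | succ n ih =>
    intro A S hS
    rw [Fin.prod_univ_castSucc, mul_comm]
    have hsub : (Finset.univ.filter fun τ : Fin (n + 1) → α =>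
        Function.Injective τ ∧ ∀ i, τ i ∈ A i ∧ τ i ∈ S) ⊆
        (A (Fin.last n) ∩ S).biUnion fun x =>
          (Finset.univ.filter fun τ : Fin n → α =>
            Function.Injective τ ∧ ∀ i, τ i ∈ A i.castSucc ∧ τ i ∈ S.erase x).image
            fun τ => (Fin.snoc τ x : Fin (n + 1) → α) := by
      intro τ hτ
      simp only [Finset.mem_filter, Finset.mem_univ, true_and] at hτ
      obtain ⟨hinj, hm⟩ := hτ
      simp only [Finset.mem_biUnion, Finset.mem_image, Finset.mem_filter, Finset.mem_univ,
        true_and, Finset.mem_inter]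
      refine ⟨τ (Fin.last n), hm _, Fin.init τ, ⟨?_, ?_⟩, Fin.snoc_init_self τ⟩
      · intro i j hij
        exact Fin.castSucc_injective n (hinj hij)
      · intro i
        refine ⟨(hm i.castSucc).1, Finset.mem_erase.2 ⟨?_, (hm i.castSucc).2⟩⟩
        intro h
        exact (Fin.castSucc_lt_last i).ne (hinj h)
    refine (Finset.card_le_card hsub).trans ?_
    refine (Finset.card_biUnion_le_card_mul _ _
      (∏ i : Fin n, min ((i : ℕ) + 1) (A i.castSucc).card) ?_).trans ?_
    · intro x hx
      refine Finset.card_image_le.trans ?_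
      refine ih (fun i => A i.castSucc) (S.erase x) ?_
      rw [Finset.card_erase_of_mem (Finset.mem_inter.1 hx).2, hS]
      rfl
    · refine Nat.mul_le_mul ?_ (le_of_eq rfl)
      refine le_min ?_ (Finset.card_le_card Finset.inter_subset_left)
      rw [Fin.val_last, ← hS]
      exact Finset.card_le_card Finset.inter_subset_right

/-- For a binary `m × m` matrix `M` with descending rearrangement
`b 0 ≥ b 1 ≥ ⋯` of its column weights, the number of permutations `σ` with
`M i (σ i) ≠ 0` for all `i` is at most `∏_{i=1}^{m} min(i, b_i)`
(1-based product, i.e. `∏ i : Fin m, min (i+1) (b i)`). -/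
theorem card_nonvanishing_perms_le_prod_min
    (m : ℕ) (M : Matrix (Fin m) (Fin m) (ZMod 2))
    (colw : Fin m → ℕ)
    (hcolw : ∀ j : Fin m, colw j = (Finset.univ.filter fun i => M i j ≠ 0).card)
    (b : Fin m → ℕ) (g : Equiv.Perm (Fin m))
    (hb : ∀ i : Fin m, b i = colw (g i))
    (hdesc : Antitone b) :
    (Finset.univ.filter fun σ : Equiv.Perm (Fin m) => ∀ i, M i (σ i) ≠ 0).card ≤
      ∏ i : Fin m, min ((i : ℕ) + 1) (b i) := by
  classical
  have h := card_inj_aux m (fun i => Finset.univ.filter fun r => M r (g i) ≠ 0)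
    Finset.univ (by simp)
  simp only [← hcolw, ← hb] at h
  refine le_trans ?_ h
  refine Finset.card_le_card_of_injOn (fun σ i => σ.symm (g i)) ?_ ?_
  · intro σ hσ
    have hσ' : ∀ i, M i (σ i) ≠ 0 := by simpa using hσ
    have key : ∀ i, M (σ.symm (g i)) (g i) ≠ 0 := fun i => by
      have := hσ' (σ.symm (g i))
      rwa [Equiv.apply_symm_apply] at this
    have hinj : Function.Injective fun i => σ.symm (g i) :=
      σ.symm.injective.comp g.injective
    simpa using And.intro hinj key
  · intro σ _ σ' _ heq
    have : σ.symm = σ'.symm := by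
      ext j
      have := congrFun heq (g.symm j)
      simp only [Equiv.apply_symm_apply] at this
      rw [this]
    simpa using congrArg Equiv.symm this
end

section
/- Let A : Matrix (Fin m) (Fin m) ((ZMod 2)[X]) be a matrix every entry of which has weight at most 1 (i.e. each entry is zero or a single monomial X^a). For each column j let c_j be the number of nonzero entries in column j, and let b_1 ≥ b_2 ≥ ⋯ ≥ b_m be c_1, …, c_m sorted in descending order. Then the weight of the determinant satisfies (det A).support.card ≤ ∏_{i=1}^{m} min(i, b_i); in particular, if b_1 ≥ 1 and k is the largest integer with 1 ≤ k ≤ m and b_k ≥ k, then (det A).support.card ≤ k! · ∏_{i=k+1}^{m} b_i. -/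
open Polynomial in
theorem aux_support_neg_one_pow_mul (n : ℕ) (p : (ZMod 2)[X]) :
    ((-1) ^ n * p).support.card = p.support.card := by
  rcases neg_one_pow_eq_or (ZMod 2)[X] n with h | h <;> simp [h]

open Polynomial in
theorem aux_support_sum {ι : Type*} (s : Finset ι) (f : ι → (ZMod 2)[X]) :
    (∑ i ∈ s, f i).support.card ≤ ∑ i ∈ s, (f i).support.card := by
  refine Finset.le_sum_of_subadditive (fun p : (ZMod 2)[X] => p.support.card) (by simp) ?_ s f
  intro p q
  exact (Finset.card_le_card Polynomial.support_add).trans (Finset.card_union_le _ _)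

/-- Expansion along the last column; no ordering of the bounds `b` is needed. -/
theorem aux_det_bound (m : ℕ) : ∀ (A : Matrix (Fin m) (Fin m) (Polynomial (ZMod 2)))
    (_ : ∀ i j, (A i j).support.card ≤ 1) (b : Fin m → ℕ)
    (_ : ∀ j, (Finset.univ.filter fun i => A i j ≠ 0).card ≤ b j),
    (A.det).support.card ≤ ∏ i : Fin m, min ((i : ℕ) + 1) (b i) := by
  induction m with
  | zero =>
    intro A _ b _
    simpa using (Finset.card_le_card (Polynomial.support_C_subset (1 : ZMod 2)))
  | succ n ih =>
    intro A hA b hb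
    rw [Matrix.det_succ_column A (Fin.last n), Fin.prod_univ_castSucc]
    refine (aux_support_sum _ _).trans ?_
    set P := ∏ i : Fin n, min (((Fin.castSucc i : Fin (n + 1)) : ℕ) + 1) (b (Fin.castSucc i)) with hP
    have key : ∀ i : Fin (n + 1),
        ((-1) ^ ((i : ℕ) + (Fin.last n : ℕ)) * A i (Fin.last n) *
          (A.submatrix i.succAbove (Fin.last n).succAbove).det).support.card ≤
          if A i (Fin.last n) ≠ 0 then P else 0 := by
      intro i
      split_ifs with h
      · rw [mul_assoc, aux_support_neg_one_pow_mul]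
        refine Polynomial.card_support_mul_le.trans ?_
        have h2 : (A.submatrix i.succAbove (Fin.last n).succAbove).det.support.card ≤ P := by
          refine ih _ (fun _ _ => hA _ _) (fun j => b (Fin.castSucc j)) ?_
          intro j
          refine le_trans ?_ (hb (Fin.castSucc j))
          refine Finset.card_le_card_of_injOn i.succAbove ?_
            (Fin.succAbove_right_injective.injOn)
          intro x hx
          simpa using hx
        calc _ ≤ 1 * P := Nat.mul_le_mul (hA _ _) h2
          _ = P := one_mul _
      · have h0 : A i (Fin.last n) = 0 := not_not.mp h
        simp [h0]
    refine (Finset.sum_le_sum fun i _ => key i).trans ?_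
    rw [← Finset.sum_filter, Finset.sum_const, smul_eq_mul, mul_comm]
    refine Nat.mul_le_mul_left _ (le_min ?_ (hb _))
    refine (Finset.card_le_univ _).trans ?_
    simp

theorem aux_fact (k m : ℕ) (hk : k < m) :
    ∏ i ∈ Finset.univ.filter (fun i : Fin m => ¬ (⟨k, hk⟩ : Fin m) < i), ((i : ℕ) + 1)
      = Nat.factorial (k + 1) := by
  rw [← Finset.prod_range_add_one_eq_factorial]
  refine Finset.prod_bij (fun i _ => (i : ℕ)) ?_ ?_ ?_ ?_
  · intro i hi
    simp [Fin.lt_def] at hi ⊢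
    omega
  · intro i _ j _ h
    exact Fin.ext h
  · intro x hx
    simp at hx
    exact ⟨⟨x, by omega⟩, by simp [Fin.lt_def]; omega, rfl⟩
  · intros
    rfl


/-- For a square matrix of polynomials over `ZMod 2` whose entries are
monomials or zero (weight ≤ 1), with `b` the descending rearrangement of the column
weights (number of nonzero entries per column), the weight of the determinant is at
most `∏_{i=1}^{m} min(i, b_i)`; in particular, if `k = kk + 1` is the largest `k` with
`1 ≤ k ≤ m` and `b_k ≥ k`, it is at most `k! · ∏_{i=k+1}^{m} b_i`. -/
theorem support_card_det_le_prod_min_of_monomial_entries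
    (m : ℕ) (A : Matrix (Fin m) (Fin m) (Polynomial (ZMod 2)))
    (hA : ∀ i j, (A i j).support.card ≤ 1)
    (colw : Fin m → ℕ)
    (hcolw : ∀ j : Fin m, colw j = (Finset.univ.filter fun i => A i j ≠ 0).card)
    (b : Fin m → ℕ) (g : Equiv.Perm (Fin m))
    (hb : ∀ i : Fin m, b i = colw (g i))
    (hdesc : Antitone b) :
    (A.det).support.card ≤ ∏ i : Fin m, min ((i : ℕ) + 1) (b i) ∧
      ∀ kk : Fin m, 1 ≤ b ⟨0, kk.pos⟩ → (kk : ℕ) + 1 ≤ b kk →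
        (∀ j : Fin m, (j : ℕ) + 1 ≤ b j → j ≤ kk) →
        (A.det).support.card ≤
          Nat.factorial ((kk : ℕ) + 1) *
            ∏ i ∈ Finset.univ.filter fun i : Fin m => kk < i, b i := by
  have h1 : (A.det).support.card ≤ ∏ i : Fin m, min ((i : ℕ) + 1) (b i) := by
    have h := aux_det_bound m (A.submatrix id g) (fun _ _ => hA _ _) b (fun j => by
      rw [hb, hcolw]; rfl)
    rw [Matrix.det_permute'] at h
    rcases Int.units_eq_one_or (Equiv.Perm.sign g) with hs | hs <;> simpa [hs] using h
  refine ⟨h1, fun kk _ _ _ => h1.trans ?_⟩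
  rw [← aux_fact kk m kk.2,
    ← Finset.prod_filter_not_mul_prod_filter Finset.univ (fun i : Fin m => kk < i)]
  exact Nat.mul_le_mul (Finset.prod_le_prod' fun i _ => min_le_left _ _)
    (Finset.prod_le_prod' fun i _ => min_le_right _ _)
end

section
/- (Theorem 2.) Let H be a type-1 quasi-cyclic parity-check matrix with m·n circulant blocks of size s×s, with n ≥ m + 1. For each column index j (1 ≤ j ≤ n) let l_j = #{i : v i j ≠ 0} be the weight of the j-th column of the weight matrix, and assume l_1 ≤ l_2 ≤ ⋯ ≤ l_n (columns sorted in ascending order of weight) and l_j ≥ 1 for all j. Let k with 1 ≤ k ≤ m be the largest integer such that l_{m+2−k} ≥ k (so l_{m+2−k} ≥ k, and l_{m+1−k} ≤ k if k < m). If k < m set ℓ = (l_2 + l_3 + ⋯ + l_{m+1−k}) / (m − k) ∈ ℚ. Then there exists a nonzero codeword c (i.e. c ≠ 0 and H.mulVec c = 0) whose weight satisfies (weight of c : ℚ) ≤ (m+1) · k! · ℓ^{m−k}, where ℓ^{m−k} is interpreted as 1 when k = m (so the bound is (m+1)·m! in that case). -/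
/-- The binary group algebra of the cyclic group of order `s`. -/
abbrev QCAlg (s : ℕ) := AddMonoidAlgebra (ZMod 2) (ZMod s)

/-- Hamming weight of an element of the group algebra. -/
def qcWt {s : ℕ} (x : QCAlg s) : ℕ := x.coeff.support.card

lemma qcWt_zero {s : ℕ} : qcWt (0 : QCAlg s) = 0 := by simp [qcWt]

lemma qcWt_add {s : ℕ} (x y : QCAlg s) : qcWt (x + y) ≤ qcWt x + qcWt y := by
  classical
  unfold qcWt
  rw [AddMonoidAlgebra.coeff_add]
  exact (Finset.card_le_card Finsupp.support_add).trans (Finset.card_union_le _ _)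

lemma qcWt_sum {s : ℕ} {ι : Type*} (t : Finset ι) (f : ι → QCAlg s) :
    qcWt (∑ i ∈ t, f i) ≤ ∑ i ∈ t, qcWt (f i) := by
  classical
  induction t using Finset.induction_on with
  | empty => simp [qcWt_zero]
  | insert a t ha ih =>
    rw [Finset.sum_insert ha, Finset.sum_insert ha]
    exact (qcWt_add _ _).trans (by omega)

lemma qcWt_neg {s : ℕ} (x : QCAlg s) : qcWt (-x) = qcWt x := by
  unfold qcWt
  rw [AddMonoidAlgebra.coeff_neg, Finsupp.support_neg]

lemma qcWt_sign {s : ℕ} (j : ℕ) (x : QCAlg s) : qcWt ((-1) ^ j * x) = qcWt x := by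
  rcases neg_one_pow_eq_or (QCAlg s) j with h | h <;> rw [h] <;> simp [qcWt_neg]

lemma qcWt_single_mul {s : ℕ} (g : ZMod s) (r : ZMod 2) (x : QCAlg s) :
    qcWt (AddMonoidAlgebra.single g r * x) ≤ qcWt x := by
  classical
  unfold qcWt
  refine Finset.card_le_card_of_injOn (fun a => -g + a) ?_ ?_
  · intro a ha
    simp only [Finset.mem_coe, Finsupp.mem_support_iff] at ha ⊢
    intro h
    apply ha
    rw [AddMonoidAlgebra.coeff_single_mul_apply, h, mul_zero]
  · intro a _ b _ h
    simpa using h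

/-- Weight bound for determinants of matrices with monomial entries. -/
lemma qcWt_det {s : ℕ} : ∀ (r : ℕ) (M : Matrix (Fin r) (Fin r) (QCAlg s)) (a : Fin r → ℕ)
    (_ : ∀ i j, ∃ g c, M i j = AddMonoidAlgebra.single g c)
    (_ : ∀ j, ∀ t : Finset (Fin r), (∀ i ∈ t, M i j ≠ 0) → t.card ≤ a j),
    qcWt M.det ≤ ∏ j : Fin r, min (a j) (r - j) := by
  classical
  intro r
  induction r with
  | zero =>
    intro M a _ _
    have : M.det = AddMonoidAlgebra.single 0 1 := by
      rw [Matrix.det_isEmpty]; rfl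
    rw [this]
    simp only [qcWt, AddMonoidAlgebra.coeff_single]
    exact (Finset.card_le_card Finsupp.support_single_subset).trans (by simp)
  | succ r ih =>
    intro M a hM ha
    rw [Matrix.det_succ_column_zero, Fin.prod_univ_succ]
    refine (qcWt_sum _ _).trans ?_
    set B := ∏ i : Fin r, min (a i.succ) (r + 1 - ((i.succ : Fin (r+1)) : ℕ)) with hB
    have hminor : ∀ i : Fin (r+1), qcWt (M.submatrix i.succAbove Fin.succ).det ≤ B := by
      intro i
      refine (ih (M.submatrix i.succAbove Fin.succ) (fun j => a j.succ)
        (fun i' j' => hM _ _) ?_).trans (le_of_eq ?_)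
      · intro j t ht
        rw [← Finset.card_map (Fin.succAboveEmb i)]
        apply ha
        intro i' hi'
        simp only [Finset.mem_map] at hi'
        obtain ⟨q, hq, rfl⟩ := hi'
        exact ht q hq
      · rw [hB]
        refine Finset.prod_congr rfl fun j _ => ?_
        simp
    have hterm : ∀ i : Fin (r+1),
        qcWt ((-1) ^ (i : ℕ) * M i 0 * (M.submatrix i.succAbove Fin.succ).det) ≤
          if M i 0 ≠ 0 then B else 0 := by
      intro i
      split_ifs with h
      · rw [mul_assoc, qcWt_sign]
        obtain ⟨g, c, hg⟩ := hM i 0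
        rw [hg]
        exact (qcWt_single_mul _ _ _).trans (hminor i)
      · simp only [not_not] at h
        simp [h, qcWt_zero]
    refine (Finset.sum_le_sum fun i _ => hterm i).trans ?_
    rw [← Finset.sum_filter, Finset.sum_const, smul_eq_mul]
    refine Nat.mul_le_mul_right _ (le_min ?_ ?_)
    · exact ha 0 _ (by simp)
    · exact (Finset.card_le_univ _).trans (by simp)

/-- Maximal nonvanishing minors give a kernel vector. -/
lemma qc_minor {R : Type*} [CommRing R] [Nontrivial R] (m : ℕ)
    (A : Matrix (Fin m) (Fin (m+1)) R) :
    ∃ r ≤ m, ∃ f : Fin r → Fin m, ∃ g : Fin (r+1) → Fin (m+1), Function.Injective f ∧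
      StrictMono g ∧
      (∃ j0, (A.submatrix f (g ∘ Fin.succAbove j0)).det ≠ 0) ∧
      ∀ i, ∑ j, A i (g j) * ((-1) ^ (j : ℕ) * (A.submatrix f (g ∘ Fin.succAbove j)).det) = 0 := by
  classical
  let P : ℕ → Prop := fun r => ∃ f : Fin r → Fin m, ∃ T : Finset (Fin (m+1)), ∃ hT : T.card = r,
    (A.submatrix f (T.orderEmbOfFin hT)).det ≠ 0
  have hinj : ∀ r (f : Fin r → Fin m) (h : Fin r → Fin (m+1)),
      (A.submatrix f h).det ≠ 0 → Function.Injective f := by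
    intro r f h hd
    by_contra hf
    simp only [Function.Injective, not_forall] at hf
    obtain ⟨a, b, hab, hne⟩ := hf
    apply hd
    refine Matrix.det_zero_of_row_eq hne ?_
    funext x
    simp [hab]
  have hP0 : P 0 := ⟨Fin.elim0, ∅, rfl, by rw [Matrix.det_isEmpty]; exact one_ne_zero⟩
  have hPle : ∀ r, P r → r ≤ m := by
    rintro r ⟨f, T, hT, hd⟩
    simpa using Fintype.card_le_of_injective f (hinj r f _ hd)
  obtain ⟨r, hr, hmax⟩ : ∃ r, P r ∧ ¬ P (r+1) := by
    by_contra hcon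
    push Not at hcon
    have : ∀ r, P r := fun r => Nat.rec hP0 (fun r h => hcon r h) r
    have := hPle _ (this (m+1))
    omega
  have hrm := hPle r hr
  obtain ⟨f, T, hT, hd⟩ := hr
  obtain ⟨x, hx⟩ : ∃ x, x ∉ T := by
    by_contra hcon
    push Not at hcon
    have : T = Finset.univ := Finset.eq_univ_iff_forall.2 hcon
    rw [this] at hT
    simp at hT
    omega
  have hT' : (insert x T).card = r + 1 := by rw [Finset.card_insert_of_notMem hx, hT]
  let g : Fin (r+1) → Fin (m+1) := (insert x T).orderEmbOfFin hT'
  have hg : StrictMono g := ((insert x T).orderEmbOfFin hT').strictMono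
  refine ⟨r, hrm, f, g, hinj r f _ hd, hg, ?_, ?_⟩
  · obtain ⟨j0, hj0⟩ : ∃ j0, g j0 = x := by
      have : x ∈ Set.range ((insert x T).orderEmbOfFin hT') := by
        rw [Finset.range_orderEmbOfFin]; simp
      exact this
    refine ⟨j0, ?_⟩
    have : g ∘ Fin.succAbove j0 = T.orderEmbOfFin hT := by
      refine Finset.orderEmbOfFin_unique hT ?_ (hg.comp (Fin.strictMono_succAbove j0))
      intro q
      have h1 : g (j0.succAbove q) ∈ insert x T := Finset.orderEmbOfFin_mem _ hT' _
      rcases Finset.mem_insert.1 h1 with h | h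
      · rw [← hj0] at h
        exact absurd (hg.injective h) (Fin.succAbove_ne _ _)
      · exact h
    rw [this]
    exact hd
  · intro i
    have h0 : (A.submatrix (Fin.cons i f : Fin (r+1) → Fin m) g).det = 0 := by
      by_contra h
      exact hmax ⟨_, _, hT', h⟩
    rw [Matrix.det_succ_row_zero] at h0
    rw [← h0]
    refine Finset.sum_congr rfl fun j _ => ?_
    have : (A.submatrix (Fin.cons i f : Fin (r+1) → Fin m) g).submatrix Fin.succ j.succAbove
        = A.submatrix f (g ∘ Fin.succAbove j) := by
      ext a b; simp
    rw [this]
    simp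
    ring

/-- AM-GM. -/
lemma qc_amgm (t : Finset ℕ) (z : ℕ → ℕ) :
    ((∏ j ∈ t, z j : ℕ) : ℚ) ≤ ((∑ j ∈ t, (z j : ℚ)) / t.card) ^ t.card := by
  rcases t.eq_empty_or_nonempty with rfl | ht
  · simp
  have hc : (0 : ℝ) < t.card := by exact_mod_cast ht.card_pos
  have h := Real.geom_mean_le_arith_mean_weighted t (fun _ => (t.card : ℝ)⁻¹) (fun j => (z j : ℝ))
    (fun _ _ => by positivity) (by simp [hc.ne']) (fun _ _ => by positivity)
  have h2 := pow_le_pow_left₀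
    (Finset.prod_nonneg fun j _ => Real.rpow_nonneg (Nat.cast_nonneg (z j)) _) h t.card
  rw [← Finset.prod_pow, ← Finset.mul_sum] at h2
  have h3 : ∏ j ∈ t, ((z j : ℝ) ^ (t.card : ℝ)⁻¹) ^ t.card = ∏ j ∈ t, (z j : ℝ) :=
    Finset.prod_congr rfl fun j _ =>
      Real.rpow_inv_natCast_pow (Nat.cast_nonneg _) ht.card_pos.ne'
  rw [h3, inv_mul_eq_div] at h2
  rw [← Rat.cast_le (K := ℝ)]
  push_cast
  exact h2

lemma qc_prod_bound (m r k : ℕ) (l : ℕ → ℕ) (hr : r ≤ m) (hk2 : k ≤ m)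
    (hmono : ∀ j₁ j₂ : ℕ, j₁ ≤ j₂ → j₂ < m + 1 → l j₁ ≤ l j₂)
    (hpos : ∀ j : ℕ, j < m + 1 → 1 ≤ l j)
    (h : Fin r → Fin (m+1)) (hh : StrictMono h) :
    ∏ j : Fin r, min (l (h j)) (r - j) ≤ k.factorial * ∏ j ∈ Finset.Ico 1 (m + 1 - k), l j := by
  have hidx : ∀ (d : ℕ) (j : Fin r), (j : ℕ) + d + 1 = r → (h j : ℕ) + d ≤ m := by
    intro d
    induction d with
    | zero => intro j _; have := (h j).2; omega
    | succ d ih =>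
      intro j hj
      have h1 := ih ⟨j + 1, by omega⟩ (by simp; omega)
      have h2 : h j < h ⟨j + 1, by omega⟩ := hh (by rw [Fin.lt_def]; simp)
      rw [Fin.lt_def] at h2
      omega
  let w : ℕ → ℕ := fun t => min (l t) (m + 1 - t)
  calc ∏ j : Fin r, min (l (h j)) (r - j) ≤ ∏ j : Fin r, w (m + 1 - r + j) := by
        refine Finset.prod_le_prod' fun j _ => ?_
        have hj := j.2
        have h1 := hidx (r - 1 - j) j (by omega)
        refine min_le_min (hmono _ _ (by omega) (by omega)) (by omega)
    _ = ∏ t ∈ Finset.Ico (m + 1 - r) (m + 1), w t := by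
        rw [Finset.prod_Ico_eq_prod_range, Fin.prod_univ_eq_prod_range (fun j => w (m + 1 - r + j))]
        congr 2
        omega
    _ ≤ ∏ t ∈ Finset.Ico 1 (m + 1), w t := by
        refine Finset.prod_le_prod_of_subset_of_one_le' (Finset.Ico_subset_Ico_left (by omega)) ?_
        intro t ht _
        have := Finset.mem_Ico.1 ht
        exact le_min (hpos t this.2) (by omega)
    _ = (∏ t ∈ Finset.Ico 1 (m + 1 - k), w t) * ∏ t ∈ Finset.Ico (m + 1 - k) (m + 1), w t := by
        rw [Finset.prod_Ico_consecutive _ (by omega) (by omega)]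
    _ ≤ (∏ t ∈ Finset.Ico 1 (m + 1 - k), l t) * k.factorial := by
        refine Nat.mul_le_mul (Finset.prod_le_prod' fun t _ => min_le_left _ _) ?_
        refine (Finset.prod_le_prod' (g := fun t => m + 1 - t) fun t _ => min_le_right _ _).trans ?_
        apply le_of_eq
        rw [Finset.prod_Ico_eq_prod_range, ← Finset.prod_range_add_one_eq_factorial,
          ← Finset.prod_range_reflect]
        have : m + 1 - (m + 1 - k) = k := by omega
        rw [this]
        refine Finset.prod_congr rfl fun j hj => ?_
        have := Finset.mem_range.1 hj
        omega
    _ = _ := mul_comm _ _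


/-- Theorem 2: For a type-1 QC LDPC code with `n ≥ m + 1`, columns of
the weight matrix sorted in ascending order of their weights `l 0 ≤ l 1 ≤ ⋯ ≤ l (n-1)`
(here `l j` is the weight of the (j+1)-th column, 0-based indexing), all weights ≥ 1,
and `k` the largest integer with `1 ≤ k ≤ m` and `l_{m+2-k} ≥ k` (1-based, i.e.
`l (m+1-k) ≥ k` 0-based), set `ℓ = (l_2 + ⋯ + l_{m+1-k})/(m-k)` (1-based). Then there
is a nonzero codeword of weight at most `(m+1) · k! · ℓ^(m-k)` (with `ℓ^0 = 1` when
`k = m`). -/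
theorem qc_min_dist_upper_bound_theorem2
    (m n s : ℕ) (hm : 0 < m) (hn : 0 < n) [NeZero s] (hnm : m + 1 ≤ n)
    (v : Fin m → Fin n → (ZMod s → ZMod 2))
    (hv : ∀ i j, ∀ a b : ZMod s, v i j a ≠ 0 → v i j b ≠ 0 → a = b)
    (H : Matrix (Fin m × ZMod s) (Fin n × ZMod s) (ZMod 2))
    (hH : ∀ (i : Fin m) (a : ZMod s) (j : Fin n) (b : ZMod s),
      H (i, a) (j, b) = v i j (a - b))
    (l : ℕ → ℕ)
    (hl : ∀ j : Fin n, l (j : ℕ) = (Finset.univ.filter fun i => v i j ≠ 0).card)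
    (hmono : ∀ j₁ j₂ : ℕ, j₁ ≤ j₂ → j₂ < n → l j₁ ≤ l j₂)
    (hpos : ∀ j : ℕ, j < n → 1 ≤ l j)
    (k : ℕ) (hk1 : 1 ≤ k) (hk2 : k ≤ m)
    (hk : k ≤ l (m + 1 - k))
    (hkmax : ∀ k' : ℕ, k < k' → k' ≤ m → l (m + 1 - k') < k') :
    ∃ c : Fin n × ZMod s → ZMod 2, c ≠ 0 ∧ H.mulVec c = 0 ∧
      ((Finset.univ.filter fun x => c x ≠ 0).card : ℚ) ≤
        (m + 1) * (Nat.factorial k) *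
          ((∑ j ∈ Finset.Ico 1 (m + 1 - k), (l j : ℚ)) / ((m : ℚ) - k)) ^ (m - k) := by
  classical
  let P : Fin m → Fin n → QCAlg s := fun i j =>
    AddMonoidAlgebra.ofCoeff (Finsupp.equivFunOnFinite.symm (v i j))
  have hPc : ∀ i j a, (P i j).coeff a = v i j a := fun _ _ _ => rfl
  have hP0 : ∀ i j, P i j ≠ 0 → v i j ≠ 0 := by
    intro i j h h0
    apply h
    ext a
    rw [hPc, h0]
    simp
  have hPs : ∀ i j, ∃ g c, P i j = AddMonoidAlgebra.single g c := by
    intro i j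
    by_cases h : ∃ a, v i j a ≠ 0
    · obtain ⟨a, ha⟩ := h
      refine ⟨a, v i j a, ?_⟩
      ext b
      rw [hPc, AddMonoidAlgebra.coeff_single, Finsupp.single_apply]
      split_ifs with hab
      · rw [hab]
      · by_contra hb
        exact hab (hv i j a b ha hb)
    · push Not at h
      refine ⟨0, 0, ?_⟩
      ext b
      rw [hPc, h b]
      simp
  let e : Fin (m+1) → Fin n := Fin.castLE hnm
  have he : Function.Injective e := Fin.castLE_injective hnm
  let A : Matrix (Fin m) (Fin (m+1)) (QCAlg s) := fun i j => P i (e j)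
  obtain ⟨r, hr, f, g, hf, hg, ⟨j0, hj0⟩, hker⟩ := qc_minor m A
  set D : Fin (r+1) → QCAlg s := fun j =>
    (-1) ^ (j : ℕ) * (A.submatrix f (g ∘ Fin.succAbove j)).det with hD
  set K := k.factorial * ∏ j ∈ Finset.Ico 1 (m + 1 - k), l j with hK
  have hDwt : ∀ j, qcWt (D j) ≤ K := by
    intro j
    rw [hD]
    simp only
    rw [qcWt_sign]
    refine (qcWt_det r _ (fun q => l (g (j.succAbove q) : ℕ)) (fun _ _ => hPs _ _) ?_).trans
      (qc_prod_bound m r k l hr hk2 (fun _ _ h1 h2 => hmono _ _ h1 (by omega))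
        (fun _ h1 => hpos _ (by omega)) (g ∘ Fin.succAbove j)
        (hg.comp (Fin.strictMono_succAbove j)))
    intro q t ht
    have h1 := hl (e (g (j.succAbove q)))
    have h2 : ((e (g (j.succAbove q)) : Fin n) : ℕ) = (g (j.succAbove q) : ℕ) := rfl
    rw [h2] at h1
    rw [h1, ← Finset.card_map ⟨f, hf⟩]
    refine Finset.card_le_card ?_
    intro i hi
    obtain ⟨p, hp, rfl⟩ := Finset.mem_map.1 hi
    simp only [Finset.mem_filter, Finset.mem_univ, true_and]
    exact hP0 _ _ (ht p hp)
  have heg : Function.Injective (e ∘ g) := he.comp hg.injective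
  let C : Fin n → QCAlg s := fun x => ∑ j, if e (g j) = x then D j else 0
  refine ⟨fun x => (C x.1).coeff x.2, ?_, ?_, ?_⟩
  · intro h
    have h1 : C (e (g j0)) = D j0 := by
      simp only [C]
      rw [Finset.sum_eq_single j0]
      · simp
      · intro b _ hb
        rw [if_neg]
        intro hh
        exact hb (heg hh)
      · simp
    have h2 : C (e (g j0)) = 0 := by
      ext b
      exact congrFun h (e (g j0), b)
    rw [h1] at h2
    apply hj0
    have h3 : (-1 : QCAlg s) ^ (j0 : ℕ) * D j0 = 0 := by rw [h2, mul_zero]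
    rw [hD] at h3
    simp only at h3
    rwa [← mul_assoc, ← mul_pow, neg_one_mul, neg_neg, one_pow, one_mul] at h3
  · have hsum : ∀ i, ∑ x, P i x * C x = 0 := by
      intro i
      rw [← hker i]
      simp only [C, Finset.mul_sum]
      rw [Finset.sum_comm]
      refine Finset.sum_congr rfl fun j _ => ?_
      rw [Finset.sum_eq_single (e (g j))]
      · simp [A, hD]
      · intro b _ hb
        rw [if_neg (Ne.symm hb), mul_zero]
      · simp
    funext ia
    obtain ⟨i, a⟩ := ia
    have h1 := congrArg (fun y : QCAlg s => y.coeff a) (hsum i)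
    simp only [AddMonoidAlgebra.coeff_sum, Finsupp.coe_finsetSum, Finset.sum_apply] at h1
    simp only [Matrix.mulVec, dotProduct, Fintype.sum_prod_type, hH]
    simp only [Pi.zero_apply]
    refine Eq.trans (Finset.sum_congr rfl fun x _ => ?_) h1
    rw [AddMonoidAlgebra.coeff_mul, Finsupp.sum_fintype _ _ (by simp)]
    have h2 : ∀ p, ((C x).coeff.sum fun m₂ r₂ => if p + m₂ = a then (P i x).coeff p * r₂ else 0)
        = ∑ b, if p + b = a then (P i x).coeff p * (C x).coeff b else 0 := fun p =>
      Finsupp.sum_fintype _ _ (by simp)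
    simp only [h2]
    rw [Finset.sum_comm]
    refine Finset.sum_congr rfl fun b _ => ?_
    rw [Finset.sum_eq_single (a - b)]
    · simp [hPc]
    · intro p _ hp
      rw [if_neg]
      intro hh
      exact hp (by rw [← hh]; abel)
    · simp
  · have hw : (Finset.univ.filter fun x : Fin n × ZMod s => (C x.1).coeff x.2 ≠ 0).card
        ≤ (m + 1) * K := by
      have h1 : (Finset.univ.filter fun x : Fin n × ZMod s => (C x.1).coeff x.2 ≠ 0).card
          = ∑ x, qcWt (C x) := by
        rw [Finset.card_filter, Fintype.sum_prod_type]
        refine Finset.sum_congr rfl fun x _ => ?_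
        rw [← Finset.card_filter]
        unfold qcWt
        congr 1
        ext b
        simp
      rw [h1]
      calc ∑ x, qcWt (C x) ≤ ∑ x, ∑ j, (if e (g j) = x then qcWt (D j) else 0) := by
            refine Finset.sum_le_sum fun x _ => (qcWt_sum _ _).trans (le_of_eq ?_)
            refine Finset.sum_congr rfl fun j _ => ?_
            split_ifs <;> simp [qcWt_zero]
        _ = ∑ j, qcWt (D j) := by
            rw [Finset.sum_comm]
            simp
        _ ≤ ∑ _j : Fin (r+1), K := Finset.sum_le_sum fun j _ => hDwt j
        _ = (r + 1) * K := by simp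
        _ ≤ (m + 1) * K := Nat.mul_le_mul_right _ (by omega)
    have hcard : (Finset.Ico 1 (m + 1 - k)).card = m - k := by
      rw [Nat.card_Ico]; omega
    have ham := qc_amgm (Finset.Ico 1 (m + 1 - k)) l
    rw [hcard, Nat.cast_sub hk2] at ham
    have hwq : ((Finset.univ.filter fun x : Fin n × ZMod s => (C x.1).coeff x.2 ≠ 0).card : ℚ)
        ≤ (m + 1) * (k.factorial *
          ((∏ j ∈ Finset.Ico 1 (m + 1 - k), l j : ℕ) : ℚ)) := by
      rw [hK] at hw
      exact_mod_cast hw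
    refine hwq.trans ?_
    rw [mul_assoc]
    gcongr
end

section
/- (Regular case.) Let H be a type-1 quasi-cyclic parity-check matrix with m·n circulant blocks of size s×s, with n ≥ m + 1, and suppose every column of its weight matrix has the same weight ℓ, where 1 ≤ ℓ ≤ m (i.e. for every j, #{i : v i j ≠ 0} = ℓ). Then there exists a nonzero codeword c with H.mulVec c = 0 whose weight is at most (m+1) · ℓ! · ℓ^{m−ℓ}. -/
/-- Abstract weight bound for determinants of sparse matrices. -/
theorem qc_det_weight {R : Type*} [CommRing R] (wt : R → ℕ) (h0 : wt 0 = 0) (h1 : wt 1 ≤ 1)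
    (hadd : ∀ a b, wt (a + b) ≤ wt a + wt b) (hmul : ∀ a b, wt (a * b) ≤ wt a * wt b)
    (hneg : ∀ a, wt (-a) ≤ wt a) (ℓ : ℕ) :
    ∀ (r : ℕ) (B : Matrix (Fin r) (Fin r) R), (∀ i j, wt (B i j) ≤ 1) →
      (∀ j, ∃ S : Finset (Fin r), (∀ i, i ∉ S → B i j = 0) ∧ S.card ≤ ℓ) →
      wt B.det ≤ ∏ k ∈ Finset.range r, min ℓ (k + 1) := by
  have hsum : ∀ {ι : Type} (S : Finset ι) (f : ι → R), wt (∑ i ∈ S, f i) ≤ ∑ i ∈ S, wt (f i) :=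
    fun S f => Finset.le_sum_of_subadditive wt h0.le hadd S f
  have hpow : ∀ k : ℕ, wt ((-1) ^ k) ≤ 1 := by
    intro k
    rcases neg_one_pow_eq_or R k with h | h <;> rw [h]
    · exact h1
    · exact (hneg 1).trans h1
  intro r
  induction r with
  | zero => intro B _ _; simpa using h1
  | succ r ih =>
    intro B hB hS
    obtain ⟨S, hS0, hSc⟩ := hS 0
    have key : B.det = ∑ i ∈ S, (-1) ^ (i : ℕ) * B i 0 *
        (B.submatrix i.succAbove Fin.succ).det := by
      rw [Matrix.det_succ_column_zero]
      symm
      apply Finset.sum_subset (Finset.subset_univ S)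
      intro i _ hi
      simp [hS0 i hi]
    rw [key, Finset.prod_range_succ]
    have hSc2 : S.card ≤ r + 1 := by simpa using Finset.card_le_univ S
    calc _ ≤ ∑ i ∈ S, wt ((-1) ^ (i : ℕ) * B i 0 * (B.submatrix i.succAbove Fin.succ).det) :=
          hsum _ _
      _ ≤ ∑ i ∈ S, ∏ k ∈ Finset.range r, min ℓ (k + 1) := by
          apply Finset.sum_le_sum
          intro i _
          have hd := ih (B.submatrix i.succAbove Fin.succ) (fun a b => hB _ _) (by
            intro j
            obtain ⟨T, hT0, hTc⟩ := hS j.succ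
            refine ⟨Finset.univ.filter fun a => i.succAbove a ∈ T, ?_, ?_⟩
            · intro a ha
              apply hT0
              simpa using ha
            · refine le_trans ?_ hTc
              apply Finset.card_le_card_of_injOn i.succAbove
              · intro a ha; simpa using ha
              · exact Fin.succAbove_right_injective.injOn)
          have h2 : wt ((-1) ^ (i : ℕ) * B i 0) ≤ 1 :=
            (hmul _ _).trans (by simpa using Nat.mul_le_mul (hpow i) (hB i 0))
          exact (hmul _ _).trans (by simpa using Nat.mul_le_mul h2 hd)
      _ = S.card * ∏ k ∈ Finset.range r, min ℓ (k + 1) := by simp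
      _ ≤ _ := by
          rw [mul_comm]
          exact Nat.mul_le_mul_left _ (le_min hSc hSc2)

theorem qc_prod_min (ℓ m : ℕ) (h : ℓ ≤ m) :
    ∏ k ∈ Finset.range m, min ℓ (k + 1) = Nat.factorial ℓ * ℓ ^ (m - ℓ) := by
  obtain ⟨d, rfl⟩ := Nat.exists_eq_add_of_le h
  rw [Finset.prod_range_add, ← Finset.prod_range_add_one_eq_factorial]
  congr 1
  · apply Finset.prod_congr rfl
    intro k hk
    have := Finset.mem_range.1 hk
    omega
  · rw [Finset.prod_congr rfl (g := fun _ => ℓ)]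
    · simp
    · intro k _
      omega

/-- Abstract kernel vector of small total weight over a commutative ring. -/
theorem qc_kernel {R : Type*} [CommRing R] [Nontrivial R] (wt : R → ℕ) (h0 : wt 0 = 0)
    (h1 : wt 1 ≤ 1)
    (hadd : ∀ a b, wt (a + b) ≤ wt a + wt b) (hmul : ∀ a b, wt (a * b) ≤ wt a * wt b)
    (hneg : ∀ a, wt (-a) ≤ wt a) (ℓ m n : ℕ) (hℓ1 : 1 ≤ ℓ) (hnm : m + 1 ≤ n)
    (A : Matrix (Fin m) (Fin n) R) (hA : ∀ i j, wt (A i j) ≤ 1)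
    (hS : ∀ j, ∃ S : Finset (Fin m), (∀ i, i ∉ S → A i j = 0) ∧ S.card ≤ ℓ) :
    ∃ C : Fin n → R, C ≠ 0 ∧ (∀ i, ∑ j, A i j * C j = 0) ∧
      ∑ j, wt (C j) ≤ (m + 1) * ∏ k ∈ Finset.range m, min ℓ (k + 1) := by
  classical
  have hsum : ∀ {ι : Type} (S : Finset ι) (f : ι → R), wt (∑ i ∈ S, f i) ≤ ∑ i ∈ S, wt (f i) :=
    fun S f => Finset.le_sum_of_subadditive wt h0.le hadd S f
  have hpow : ∀ k : ℕ, wt ((-1) ^ k) ≤ 1 := by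
    intro k
    rcases neg_one_pow_eq_or R k with h | h <;> rw [h]
    · exact h1
    · exact (hneg 1).trans h1
  let P : ℕ → Prop := fun r => ∃ (f : Fin r → Fin m) (g : Fin r → Fin n),
    (A.submatrix f g).det ≠ 0
  have finj : ∀ r (f : Fin r → Fin m) (g : Fin r → Fin n),
      (A.submatrix f g).det ≠ 0 → Function.Injective f := by
    intro r f g hd a b hab
    by_contra hne
    exact hd (Matrix.det_zero_of_row_eq hne (by ext j; simp [hab]))
  have hPm : ∀ r, P r → r ≤ m := by
    rintro r ⟨f, g, hd⟩
    simpa using Fintype.card_le_of_injective f (finj r f g hd)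
  have hP0 : P 0 := ⟨Fin.elim0, Fin.elim0, by simp⟩
  obtain ⟨r, hPr, hPr1⟩ : ∃ r, P r ∧ ¬ P (r + 1) := by
    by_contra hcon
    push Not at hcon
    have hall : ∀ r, P r := fun r => Nat.rec hP0 hcon r
    have := hPm _ (hall (m + 1))
    omega
  have hrm := hPm r hPr
  obtain ⟨f, g, hd⟩ := hPr
  have hf := finj r f g hd
  obtain ⟨j0, hj0⟩ : ∃ j0, ∀ k, g k ≠ j0 := by
    by_contra hcon
    push Not at hcon
    have := Fintype.card_le_of_surjective g hcon
    simp at this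
    omega
  let g' : Fin (r + 1) → Fin n := Fin.cons j0 g
  let D : Fin (r + 1) → R := fun k => (-1) ^ (k : ℕ) * (A.submatrix f (g' ∘ k.succAbove)).det
  have hDw : ∀ k, wt (D k) ≤ ∏ k ∈ Finset.range r, min ℓ (k + 1) := by
    intro k
    have hd := qc_det_weight wt h0 h1 hadd hmul hneg ℓ r (A.submatrix f (g' ∘ k.succAbove))
      (fun a b => hA _ _) (by
        intro j
        obtain ⟨T, hT0, hTc⟩ := hS ((g' ∘ k.succAbove) j)
        refine ⟨Finset.univ.filter fun a => f a ∈ T, ?_, ?_⟩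
        · intro a ha
          apply hT0
          simpa using ha
        · refine le_trans ?_ hTc
          apply Finset.card_le_card_of_injOn f
          · intro a ha; simpa using ha
          · exact hf.injOn)
    exact (hmul _ _).trans (by simpa using Nat.mul_le_mul (hpow k) hd)
  refine ⟨fun j => ∑ k, if g' k = j then D k else 0, ?_, ?_, ?_⟩
  · intro hC
    have h := congrFun hC j0
    apply hd
    have hz : ∀ k : Fin r, g' k.succ ≠ j0 := fun k => by simpa [g'] using hj0 k
    rw [Fin.sum_univ_succ] at h
    simp only [hz, if_false, Finset.sum_const_zero, add_zero] at h
    have hg : g' ∘ Fin.succ = g := by ext k; simp [g']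
    simpa [D, hg, show g' 0 = j0 from rfl, Fin.succAbove_zero] using h
  · intro i
    have hz : (A.submatrix (Fin.cons i f : Fin (r + 1) → Fin m) g').det = 0 := by
      by_contra hne
      exact hPr1 ⟨_, _, hne⟩
    rw [Matrix.det_succ_row_zero] at hz
    refine Eq.trans ?_ hz
    simp_rw [Finset.mul_sum]
    rw [Finset.sum_comm]
    apply Finset.sum_congr rfl
    intro k _
    simp only [mul_ite, mul_zero, Finset.sum_ite_eq, Finset.mem_univ, if_true]
    have hsub : (A.submatrix (Fin.cons i f : Fin (r + 1) → Fin m) g').submatrix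
        Fin.succ k.succAbove = A.submatrix f (g' ∘ k.succAbove) := by
      ext a b; simp
    rw [hsub]
    simp [D]
    ring
  · calc _ ≤ ∑ j, ∑ k, wt (if g' k = j then D k else 0) :=
          Finset.sum_le_sum fun j _ => hsum _ _
      _ = ∑ k, wt (D k) := by
          rw [Finset.sum_comm]
          apply Finset.sum_congr rfl
          intro k _
          simp [apply_ite wt, h0]
      _ ≤ ∑ k : Fin (r + 1), ∏ k ∈ Finset.range r, min ℓ (k + 1) :=
          Finset.sum_le_sum fun k _ => hDw k
      _ = (r + 1) * ∏ k ∈ Finset.range r, min ℓ (k + 1) := by simp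
      _ ≤ _ := by
          apply Nat.mul_le_mul (by omega)
          apply Finset.prod_le_prod_of_subset_of_one_le'
          · exact Finset.range_mono hrm
          · intro k _ _
            exact le_min hℓ1 (by omega)

/-- regular case: For a type-1 QC LDPC code with `n ≥ m + 1` whose
weight matrix has all column weights equal to `ℓ`, `1 ≤ ℓ ≤ m`, there is a nonzero
codeword of weight at most `(m+1) · ℓ! · ℓ^(m-ℓ)`. -/
theorem qc_min_dist_upper_bound_regular
    (m n s : ℕ) (hm : 0 < m) (hn : 0 < n) [NeZero s] (hnm : m + 1 ≤ n)
    (v : Fin m → Fin n → (ZMod s → ZMod 2))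
    (hv : ∀ i j, ∀ a b : ZMod s, v i j a ≠ 0 → v i j b ≠ 0 → a = b)
    (H : Matrix (Fin m × ZMod s) (Fin n × ZMod s) (ZMod 2))
    (hH : ∀ (i : Fin m) (a : ZMod s) (j : Fin n) (b : ZMod s),
      H (i, a) (j, b) = v i j (a - b))
    (ℓ : ℕ) (hℓ1 : 1 ≤ ℓ) (hℓm : ℓ ≤ m)
    (hreg : ∀ j : Fin n, (Finset.univ.filter fun i => v i j ≠ 0).card = ℓ) :
    ∃ c : Fin n × ZMod s → ZMod 2, c ≠ 0 ∧ H.mulVec c = 0 ∧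
      (Finset.univ.filter fun x => c x ≠ 0).card ≤
        (m + 1) * Nat.factorial ℓ * ℓ ^ (m - ℓ) := by
  classical
  let A : Matrix (Fin m) (Fin n) (AddMonoidAlgebra (ZMod 2) (ZMod s)) :=
    fun i j => .ofCoeff (Finsupp.equivFunOnFinite.symm (v i j))
  have hAc : ∀ i j a, (A i j).coeff a = v i j a := fun i j a => rfl
  obtain ⟨C, hC0, hCk, hCw⟩ := qc_kernel
    (fun x : AddMonoidAlgebra (ZMod 2) (ZMod s) => x.coeff.support.card)
    (by simp)
    (by
      rw [AddMonoidAlgebra.one_def]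
      exact (Finset.card_le_card Finsupp.support_single_subset).trans (by simp))
    (fun a b => (Finset.card_le_card Finsupp.support_add).trans (Finset.card_union_le _ _))
    (fun a b => (Finset.card_le_card (AddMonoidAlgebra.support_coeff_mul_subset a b)).trans
      Finset.card_add_le)
    (fun a => by simp)
    ℓ m n hℓ1 hnm A
    (by
      intro i j
      rw [Finset.card_le_one]
      intro a ha b hb
      simp only [Finsupp.mem_support_iff, hAc] at ha hb
      exact hv i j a b ha hb)
    (by
      intro j
      refine ⟨_, ?_, (hreg j).le⟩
      intro i hi
      have hvz : v i j = 0 := by simpa using hi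
      ext a
      simp [hAc, hvz])
  refine ⟨fun x => (C x.1).coeff x.2, ?_, ?_, ?_⟩
  · intro h
    apply hC0
    ext j a
    exact congrFun h (j, a)
  · ext ⟨i, a⟩
    have h := congrArg (fun x => x.coeff a) (hCk i)
    simp only [AddMonoidAlgebra.coeff_sum, Finsupp.finsetSum_apply,
      AddMonoidAlgebra.coeff_zero, Finsupp.coe_zero, Pi.zero_apply] at h
    rw [Pi.zero_apply, ← h]
    simp only [Matrix.mulVec, dotProduct, Fintype.sum_prod_type, hH]
    apply Finset.sum_congr rfl
    intro j _
    rw [AddMonoidAlgebra.coeff_mul_apply_right, Finsupp.sum_fintype _ _ (by simp)]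
    apply Finset.sum_congr rfl
    intro b _
    simp [hAc, sub_eq_add_neg]
  · rw [mul_assoc, ← qc_prod_min ℓ m hℓm]
    refine le_trans (le_of_eq ?_) hCw
    rw [Finset.card_filter, Fintype.sum_prod_type]
    apply Finset.sum_congr rfl
    intro j _
    rw [← Finset.card_filter]
    congr 1
    ext a
    simp
end

section
/- (All-ones base matrix.) Let H be a type-1 quasi-cyclic parity-check matrix with m·n circulant blocks of size s×s, with n ≥ m + 1, such that every block is a nonzero circulant of weight exactly 1 (i.e. v i j ≠ 0 for all i, j; the weight matrix is the all-ones m×n matrix). Then there exists a nonzero codeword c with H.mulVec c = 0 whose weight is at most (m+1)!. -/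
section QCHelpers
open AddMonoidAlgebra

/-- A determinant of a `k × k` matrix of monomials has at most `k!` terms. -/
lemma qc_card_support_det {s k : ℕ} (e : Fin k → Fin k → ZMod s) :
    (Matrix.det (Matrix.of fun i j =>
      AddMonoidAlgebra.of (ZMod 2) (ZMod s) (Multiplicative.ofAdd (e i j)))).coeff.support.card
      ≤ Nat.factorial k := by
  classical
  rw [Matrix.det_apply, AddMonoidAlgebra.coeff_sum]
  refine (Finset.card_le_card Finsupp.support_finsetSum).trans ?_
  refine Finset.card_biUnion_le.trans ?_
  refine (Finset.sum_le_card_nsmul _ _ 1 ?_).trans ?_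
  · intro σ _
    simp only [Matrix.of_apply]
    rw [← map_prod]
    rcases Int.units_eq_one_or (Equiv.Perm.sign σ) with h | h
    · rw [h, one_smul, AddMonoidAlgebra.of_apply, AddMonoidAlgebra.coeff_single]
      exact (Finset.card_le_card Finsupp.support_single_subset).trans (by simp)
    · rw [h, Units.neg_smul, one_smul, AddMonoidAlgebra.coeff_neg, Finsupp.support_neg,
        AddMonoidAlgebra.of_apply, AddMonoidAlgebra.coeff_single]
      exact (Finset.card_le_card Finsupp.support_single_subset).trans (by simp)
  · simp [Fintype.card_perm]

/-- McCoy-type argument: a short kernel vector over the group algebra. -/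
lemma qc_kernel_s13 {m n s : ℕ} (hnm : m + 1 ≤ n) (e : Fin m → Fin n → ZMod s) :
    ∃ d : Fin n → AddMonoidAlgebra (ZMod 2) (ZMod s), d ≠ 0 ∧
      (∀ i, ∑ j, AddMonoidAlgebra.of (ZMod 2) (ZMod s) (Multiplicative.ofAdd (e i j)) * d j = 0) ∧
      ∑ j, (d j).coeff.support.card ≤ Nat.factorial (m + 1) := by
  classical
  set A : Matrix (Fin m) (Fin n) (AddMonoidAlgebra (ZMod 2) (ZMod s)) :=
    Matrix.of fun i j => AddMonoidAlgebra.of (ZMod 2) (ZMod s) (Multiplicative.ofAdd (e i j)) with hA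
  let P : ℕ → Prop := fun k => ∃ (r : Fin k → Fin m) (t : Fin k → Fin n), (A.submatrix r t).det ≠ 0
  have hP0 : P 0 := ⟨Fin.elim0, Fin.elim0, by simp⟩
  have hPm : ¬ P (m + 1) := by
    rintro ⟨r, t, h⟩
    have : ¬ Function.Injective r := fun hr => by
      have := Fintype.card_le_of_injective r hr
      simp at this
    simp only [Function.Injective, not_forall] at this
    obtain ⟨a, b, hab, hne⟩ := this
    exact h (Matrix.det_zero_of_row_eq hne (by ext j; simp [hab]))
  obtain ⟨k, hk, hPk, hPk1⟩ : ∃ k, k ≤ m ∧ P k ∧ ¬ P (k + 1) := by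
    by_contra! hc
    have : ∀ k, k ≤ m + 1 → P k := by
      intro k
      induction k with
      | zero => intro _; exact hP0
      | succ k ih => intro hk; exact hc k (by omega) (ih (by omega))
    exact hPm (this _ le_rfl)
  obtain ⟨r, t, hdet⟩ := hPk
  have ht : Function.Injective t := by
    intro a b hab
    by_contra hne
    exact hdet (Matrix.det_zero_of_column_eq hne (by intro j; simp [hab]))
  obtain ⟨j0, hj0⟩ : ∃ j0, j0 ∉ Set.range t := by
    by_contra! hc
    have := Fintype.card_le_of_surjective t hc
    simp at this
    omega
  let t' : Fin (k + 1) → Fin n := Fin.cons j0 t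
  have ht' : Function.Injective t' := Fin.cons_injective_iff.2 ⟨hj0, ht⟩
  let D : Fin (k + 1) → AddMonoidAlgebra (ZMod 2) (ZMod s) := fun j =>
    (-1) ^ (j : ℕ) * (A.submatrix r (t' ∘ j.succAbove)).det
  let d : Fin n → AddMonoidAlgebra (ZMod 2) (ZMod s) := Function.extend t' D 0
  have hd : ∀ j, d (t' j) = D j := fun j => ht'.extend_apply _ _ _
  have hd0 : ∀ j, j ∉ Set.range t' → d j = 0 := fun j hj =>
    Function.extend_apply' _ _ _ (fun ⟨a, ha⟩ => hj ⟨a, ha⟩)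
  have hDcard : ∀ j, (D j).coeff.support.card ≤ Nat.factorial k := by
    intro j
    have h := qc_card_support_det (fun a b => e (r a) ((t' ∘ j.succAbove) b))
    rcases neg_one_pow_eq_or (AddMonoidAlgebra (ZMod 2) (ZMod s)) (j : ℕ) with h1 | h1
    · simp only [D, h1, one_mul]
      exact h
    · simp only [D, h1, neg_mul, one_mul, AddMonoidAlgebra.coeff_neg, Finsupp.support_neg]
      exact h
  refine ⟨d, ?_, ?_, ?_⟩
  · intro h
    apply hdet
    have h2 := hd 0
    rw [h] at h2
    have h3 : t' ∘ Fin.succ = t := by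
      ext x; simp [t']
    simpa [D, h3] using h2.symm
  · intro i
    have h1 : (A.submatrix (Fin.cons i r : Fin (k + 1) → Fin m) t').det = 0 := by
      by_contra h
      exact hPk1 ⟨_, _, h⟩
    rw [Matrix.det_succ_row_zero] at h1
    rw [← h1]
    symm
    refine Finset.sum_of_injOn t' ht'.injOn (by simp) ?_ ?_
    · intro j _ hj
      rw [hd0 j (by simpa using hj), mul_zero]
    · intro j _
      rw [hd]
      simp only [D, Matrix.submatrix_apply, Fin.cons_zero, Matrix.submatrix_submatrix]
      have : (Fin.cons i r : Fin (k + 1) → Fin m) ∘ Fin.succ = r := by ext x; simp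
      rw [this]
      simp only [hA, Matrix.of_apply]
      ring
  · have : ∑ j, (d j).coeff.support.card = ∑ j, (D j).coeff.support.card := by
      symm
      refine Finset.sum_of_injOn t' ht'.injOn (by simp) ?_ ?_
      · intro j _ hj
        rw [hd0 j (by simpa using hj)]; simp
      · intro j _
        rw [hd]
    rw [this]
    refine (Finset.sum_le_card_nsmul _ _ _ (fun j _ => hDcard j)).trans ?_
    simp only [Finset.card_univ, Fintype.card_fin, smul_eq_mul]
    rw [← Nat.factorial_succ]
    exact Nat.factorial_le (by omega)

end QCHelpers

/-- all-ones base matrix: For a type-1 QC LDPC code with `n ≥ m + 1`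
whose blocks are all nonzero circulants of weight 1 (all-ones weight matrix), there is
a nonzero codeword of weight at most `(m+1)!`. -/
theorem qc_min_dist_upper_bound_all_ones
    (m n s : ℕ) (hm : 0 < m) (hn : 0 < n) [NeZero s] (hnm : m + 1 ≤ n)
    (v : Fin m → Fin n → (ZMod s → ZMod 2))
    (hv : ∀ i j, ∀ a b : ZMod s, v i j a ≠ 0 → v i j b ≠ 0 → a = b)
    (H : Matrix (Fin m × ZMod s) (Fin n × ZMod s) (ZMod 2))
    (hH : ∀ (i : Fin m) (a : ZMod s) (j : Fin n) (b : ZMod s),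
      H (i, a) (j, b) = v i j (a - b))
    (hall : ∀ i j, v i j ≠ 0) :
    ∃ c : Fin n × ZMod s → ZMod 2, c ≠ 0 ∧ H.mulVec c = 0 ∧
      (Finset.univ.filter fun x => c x ≠ 0).card ≤ Nat.factorial (m + 1) := by
  classical
  have hex : ∀ i j, ∃ a, v i j a ≠ 0 := fun i j => Function.ne_iff.1 (hall i j)
  choose e he using hex
  have h01 : ∀ x : ZMod 2, x ≠ 0 → x = 1 := by decide
  have hve : ∀ i j a, v i j a = if a = e i j then 1 else 0 := by
    intro i j a
    split_ifs with h
    · rw [h]; exact h01 _ (he i j)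
    · by_contra h2
      exact h (hv i j _ _ h2 (he i j))
  obtain ⟨d, hd0, hd, hcard⟩ := qc_kernel_s13 hnm e
  refine ⟨fun x => (d x.1).coeff x.2, ?_, ?_, ?_⟩
  · intro h
    apply hd0
    ext j b
    exact congrFun h (j, b)
  · ext ⟨i, a⟩
    have h1 := congrArg (fun f => f.coeff a) (hd i)
    simp only [AddMonoidAlgebra.coeff_sum, Finsupp.finsetSum_apply, AddMonoidAlgebra.of_apply,
      toAdd_ofAdd, AddMonoidAlgebra.coeff_zero, Finsupp.coe_zero, Pi.zero_apply] at h1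
    simp only [Matrix.mulVec, dotProduct, Fintype.sum_prod_type, hH, hve, Pi.zero_apply]
    refine Eq.trans ?_ h1
    refine Finset.sum_congr rfl fun j _ => ?_
    rw [AddMonoidAlgebra.coeff_single_mul_apply, one_mul]
    rw [Finset.sum_eq_single (-e i j + a)]
    · simp
    · intro b _ hb
      rw [if_neg, zero_mul]
      rintro h
      apply hb
      rw [← h]; abel
    · simp
  · refine le_trans (le_of_eq ?_) hcard
    rw [← Finset.card_sigma]
    refine Finset.card_bij (fun x _ => ⟨x.1, x.2⟩) ?_ ?_ ?_
    · intro x hx; simpa using hx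
    · rintro ⟨a, b⟩ _ ⟨c, d⟩ _ h; simpa using h
    · rintro ⟨a, b⟩ h; exact ⟨(a, b), by simpa using h, rfl⟩
end

section
/- (Sublinearity of minimum distance in s.) Fix m and n with n ≥ m + 1, and fix a target weight matrix given by W : Fin m → Fin n → Prop (decidable) whose column weights l_j = #{i : W i j} satisfy l_1 ≤ ⋯ ≤ l_n and l_j ≥ 1 for all j. Then for every ε > 0 there exists s_0 such that for every s ≥ s_0 and every type-1 quasi-cyclic parity-check matrix H built from a family v : Fin m → Fin n → (ZMod s → ZMod 2) with (v i j ≠ 0 ↔ W i j), there exists a nonzero codeword c with H.mulVec c = 0 whose weight is less than ε · (n · s). In other words, the minimum distance of every type-1 QC LDPC code with this weight matrix is bounded by a constant independent of s, so the ratio of minimum distance to code length N = n·s tends to 0 as s → ∞. -/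
theorem qc_growth (m d : ℕ) (hm : 0 < m) :
    ∃ K : ℕ, m ^ K * (K + 1) ^ d < (m + 1) ^ K := by
  have hm' : (0 : ℝ) < m := by exact_mod_cast hm
  set r : ℝ := ((m : ℝ) + 1) / m with hr
  have hr1 : 1 < r := by rw [hr, lt_div_iff₀ hm']; linarith
  have hr0 : 0 < r := by linarith
  have h := tendsto_pow_const_div_const_pow_of_one_lt d hr1
  have h2 := (h.eventually (gt_mem_nhds (show (0 : ℝ) < 1 / r by positivity))).and
    (Filter.eventually_ge_atTop 1)
  obtain ⟨N, hN, hN1⟩ := h2.exists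
  obtain ⟨K, rfl⟩ : ∃ K, N = K + 1 := ⟨N - 1, by omega⟩
  refine ⟨K, ?_⟩
  rw [div_lt_div_iff₀ (by positivity) hr0, one_mul, pow_succ r] at hN
  have h3 := lt_of_mul_lt_mul_right hN hr0.le
  rw [hr, div_pow, lt_div_iff₀ (by positivity)] at h3
  have h4 : ((m ^ K * (K + 1) ^ d : ℕ) : ℝ) < ((m + 1) ^ K : ℕ) := by
    push_cast at h3 ⊢
    linarith
  exact_mod_cast h4

/-- The box of nonnegative combinations with coefficients at most `k`. -/
noncomputable def qcBox {ι : Type} [Fintype ι] [DecidableEq ι] {s : ℕ} (a : ι → ZMod s) (k : ℕ) :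
    Finset (ZMod s) :=
  Finset.univ.image fun e : ι → Fin (k + 1) => ∑ p, (e p : ℕ) • a p

theorem qcBox_card {ι : Type} [Fintype ι] [DecidableEq ι] {s : ℕ} (a : ι → ZMod s) (k : ℕ) :
    (qcBox a k).card ≤ (k + 1) ^ Fintype.card ι := by
  refine Finset.card_image_le.trans ?_
  simp

theorem qcBox_pos {ι : Type} [Fintype ι] [DecidableEq ι] {s : ℕ} (a : ι → ZMod s) (k : ℕ) :
    1 ≤ (qcBox a k).card :=
  Finset.card_pos.mpr (Finset.univ_nonempty.image _)

theorem qcBox_add {ι : Type} [Fintype ι] [DecidableEq ι] {s : ℕ} (a : ι → ZMod s) (k : ℕ)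
    (b : ZMod s) (hb : b ∈ qcBox a k) (q : ι) : a q + b ∈ qcBox a (k + 1) := by
  obtain ⟨e, -, rfl⟩ := Finset.mem_image.mp hb
  refine Finset.mem_image.mpr
    ⟨fun p => ⟨(e p : ℕ) + if p = q then 1 else 0, ?_⟩, Finset.mem_univ _, ?_⟩
  · have := (e p).2
    split_ifs <;> omega
  · simp only [add_smul, Finset.sum_add_distrib, ite_smul, one_smul, zero_smul,
      Finset.sum_ite_eq', Finset.sum_ite_eq, Finset.mem_univ, if_true]
    rw [add_comm]

theorem qc_exists_level (m n K : ℕ) (hnm : m + 1 ≤ n) (d : ℕ)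
    (hK : m ^ K * (K + 1) ^ d < (m + 1) ^ K) (f : ℕ → ℕ) (hf0 : 1 ≤ f 0)
    (hf : f K ≤ (K + 1) ^ d) : ∃ k < K, m * f (k + 1) < n * f k := by
  by_contra! hcon
  have key : ∀ k ≤ K, (m + 1) ^ k ≤ m ^ k * f k := by
    intro k
    induction k with
    | zero => intro _; simpa using hf0
    | succ k ih =>
      intro hk
      have h1 := ih (by omega)
      have h2 := hcon k (by omega)
      calc (m + 1) ^ (k + 1) = (m + 1) ^ k * (m + 1) := pow_succ _ _
        _ ≤ m ^ k * f k * n := Nat.mul_le_mul h1 hnm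
        _ = m ^ k * (n * f k) := by ring
        _ ≤ m ^ k * (m * f (k + 1)) := Nat.mul_le_mul_left _ h2
        _ = m ^ (k + 1) * f (k + 1) := by ring
  have := key K le_rfl
  have := Nat.mul_le_mul_left (m ^ K) hf
  omega

theorem qc_solve (m n s : ℕ) [NeZero s] (v : Fin m → Fin n → (ZMod s → ZMod 2))
    (a : Fin m → Fin n → ZMod s) (ha : ∀ i j t, v i j t ≠ 0 → t = a i j)
    (B B' : Finset (ZMod s)) (hB : ∀ b ∈ B, ∀ i j, a i j + b ∈ B')
    (hcard : m * B'.card < n * B.card) :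
    ∃ c : Fin n × ZMod s → ZMod 2, c ≠ 0 ∧
      (Matrix.of fun (p : Fin m × ZMod s) (q : Fin n × ZMod s) =>
        v p.1 q.1 (p.2 - q.2)).mulVec c = 0 ∧
      (Finset.univ.filter fun x => c x ≠ 0).card ≤ n * B.card := by
  classical
  let M : Matrix (Fin m × B') (Fin n × B) (ZMod 2) :=
    Matrix.of fun p q => v p.1 q.1 ((p.2 : ZMod s) - (q.2 : ZMod s))
  have hker : LinearMap.ker M.mulVecLin ≠ ⊥ := by
    apply LinearMap.ker_ne_bot_of_finrank_lt
    simpa using hcard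
  obtain ⟨x, hx, hx0⟩ := (Submodule.ne_bot_iff _).mp hker
  have hx' : M.mulVec x = 0 := by simpa using hx
  let c : Fin n × ZMod s → ZMod 2 := fun q => if h : q.2 ∈ B then x (q.1, ⟨q.2, h⟩) else 0
  have hcsupp : ∀ q, c q ≠ 0 → q.2 ∈ B := by
    intro q hq
    by_contra h
    exact hq (by simp [c, h])
  refine ⟨c, ?_, ?_, ?_⟩
  · intro hc
    apply hx0
    funext q
    have := congrFun hc (q.1, (q.2 : ZMod s))
    simpa [c] using this
  · funext p
    obtain ⟨i, t⟩ := p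
    by_cases ht : t ∈ B'
    · have h := congrFun hx' (i, ⟨t, ht⟩)
      simp only [Matrix.mulVec, dotProduct, M, Matrix.of_apply, Pi.zero_apply,
        Fintype.sum_prod_type] at h ⊢
      rw [← h]
      refine Finset.sum_congr rfl fun j _ => ?_
      rw [← Finset.sum_subset (Finset.subset_univ B), ← Finset.sum_coe_sort B]
      · refine Finset.sum_congr rfl fun b _ => ?_
        simp [c]
      · intro b _ hb
        simp [c, hb]
    · simp only [Matrix.mulVec, dotProduct, Matrix.of_apply, Pi.zero_apply]
      refine Finset.sum_eq_zero fun q _ => ?_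
      by_contra hne
      have h1 := left_ne_zero_of_mul hne
      have h2 := hcsupp q (right_ne_zero_of_mul hne)
      have h3 := hB _ h2 i q.1
      rw [← ha _ _ _ h1, sub_add_cancel] at h3
      exact ht h3
  · calc _ ≤ ((Finset.univ : Finset (Fin n)) ×ˢ B).card := by
          apply Finset.card_le_card
          intro q hq
          simpa using hcsupp q (by simpa using hq)
      _ = n * B.card := by simp

/-- sublinearity of the minimum distance in `s`: Fix `m`, `n ≥ m + 1`
and a target weight matrix `W` with ascending column weights `l j ≥ 1`. For every
`ε > 0` there is `s₀` such that for all `s ≥ s₀` every type-1 QC parity-check matrix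
with weight matrix `W` and circulant size `s` admits a nonzero codeword of weight
less than `ε · (n · s)`. -/
theorem qc_min_dist_sublinear_in_s
    (m n : ℕ) (hm : 0 < m) (hn : 0 < n) (hnm : m + 1 ≤ n)
    (W : Fin m → Fin n → Prop) [∀ i j, Decidable (W i j)]
    (l : ℕ → ℕ)
    (hl : ∀ j : Fin n, l (j : ℕ) = (Finset.univ.filter fun i => W i j).card)
    (hmono : ∀ j₁ j₂ : ℕ, j₁ ≤ j₂ → j₂ < n → l j₁ ≤ l j₂)
    (hpos : ∀ j : ℕ, j < n → 1 ≤ l j) :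
    ∀ ε : ℝ, 0 < ε → ∃ s₀ : ℕ, ∀ s : ℕ, s₀ ≤ s → ∀ [NeZero s],
      ∀ v : Fin m → Fin n → (ZMod s → ZMod 2),
        (∀ i j, ∀ a b : ZMod s, v i j a ≠ 0 → v i j b ≠ 0 → a = b) →
        (∀ i j, v i j ≠ 0 ↔ W i j) →
        ∃ c : Fin n × ZMod s → ZMod 2, c ≠ 0 ∧
          (Matrix.of fun (p : Fin m × ZMod s) (q : Fin n × ZMod s) =>
            v p.1 q.1 (p.2 - q.2)).mulVec c = 0 ∧
          ((Finset.univ.filter fun x => c x ≠ 0).card : ℝ) < ε * (n * s) := by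
  intro ε hε
  obtain ⟨K, hK⟩ := qc_growth m (m * n) hm
  obtain ⟨s₀, hs₀⟩ := exists_nat_gt (((K + 1 : ℕ) ^ (m * n) : ℝ) / ε)
  refine ⟨s₀, fun s hs _ v hv _ => ?_⟩
  classical
  have hex : ∀ i j, ∃ a : ZMod s, ∀ t, v i j t ≠ 0 → t = a := by
    intro i j
    by_cases h : ∃ b, v i j b ≠ 0
    · obtain ⟨b, hb⟩ := h
      exact ⟨b, fun t ht => hv i j t b ht hb⟩
    · exact ⟨0, fun t ht => absurd ⟨t, ht⟩ h⟩
  choose a ha using hex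
  let a' : Fin m × Fin n → ZMod s := fun p => a p.1 p.2
  have hc : ∀ k, (qcBox a' k).card ≤ (k + 1) ^ (m * n) := fun k => by
    simpa using qcBox_card a' k
  obtain ⟨k, hkK, hk⟩ := qc_exists_level m n K hnm (m * n) hK
    (fun k => (qcBox a' k).card) (qcBox_pos a' 0) (hc K)
  obtain ⟨c, hc0, hcH, hcw⟩ := qc_solve m n s v a ha (qcBox a' k) (qcBox a' (k + 1))
    (fun b hb i j => qcBox_add a' k b hb (i, j)) hk
  refine ⟨c, hc0, hcH, ?_⟩
  have h1 : (Finset.univ.filter fun x => c x ≠ 0).card ≤ n * (K + 1) ^ (m * n) :=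
    hcw.trans (Nat.mul_le_mul_left _ ((hc k).trans (Nat.pow_le_pow_left (by omega) _)))
  have h2 : ((Finset.univ.filter fun x => c x ≠ 0).card : ℝ)
      ≤ n * ((K + 1 : ℕ) : ℝ) ^ (m * n) := by exact_mod_cast h1
  rw [div_lt_iff₀ hε] at hs₀
  have hs' : (s₀ : ℝ) ≤ s := by exact_mod_cast hs
  have hn' : (0 : ℝ) < n := by exact_mod_cast hn
  calc _ ≤ _ := h2
    _ < n * (s₀ * ε) := mul_lt_mul_of_pos_left hs₀ hn'
    _ ≤ n * (s * ε) := by gcongr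
    _ = ε * (n * s) := by ring
end
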